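/- Let n1, n2 ≥ 2 be integers with n1·n2 even, and let τ1, τ2 ∈ ℝ be such that there exist z1, z2 ∈ ℂ with z1² = τ1, z2² = τ2 and the pair (z1,z2) (n1,n2)-independent. Then the square matrix M = M(n1,n2,τ1,τ2) of order 2n1n2−1 has rank exactly 2n1n2−2. -/

import Mathlib

open Matrix Kronecker

noncomputable section

/-- The modified Kac matrix `𝒦(n,y)`: its 1-based entry `(i,j)` equals `(n-j)·y` if `j = i-1`,
equals `i` if `j = i+1`, and equals `0` otherwise. -/
def kacM (R : Type*) [CommRing R] (n : ℕ) (y : R) : Matrix (Fin n) (Fin n) R :=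
  Matrix.of fun i j =>
    if (i : ℕ) = (j : ℕ) + 1 then ((n - 1 - (j : ℕ) : ℕ) : R) * y
    else if (j : ℕ) = (i : ℕ) + 1 then (((i : ℕ) + 1 : ℕ) : R)
    else 0

/-- The modified Kac matrix of second type `K(n1,n2,x,y)`, indexed by pairs
`(block index, index inside block)`; the pair `(u,v)` (0-based) corresponds to the
1-based position `u·n2 + v + 1`.  Its `n2×n2` blocks `K_{ij}` (1-based) are
`𝒦(n2,y)` if `i = j`, `(n1-j)·x·I` if `j = i-1`, `i·I` if `j = i+1`, and `0` otherwise. -/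
def kac2M (R : Type*) [CommRing R] (n1 n2 : ℕ) (x y : R) :
    Matrix (Fin n1 × Fin n2) (Fin n1 × Fin n2) R :=
  Matrix.of fun p q =>
    if p.1 = q.1 then kacM R n2 y p.2 q.2
    else if (p.1 : ℕ) = (q.1 : ℕ) + 1 then
      (if p.2 = q.2 then ((n1 - 1 - (q.1 : ℕ) : ℕ) : R) * x else 0)
    else if (q.1 : ℕ) = (p.1 : ℕ) + 1 then
      (if p.2 = q.2 then (((p.1 : ℕ) + 1 : ℕ) : R) else 0)
    else 0

/-- A pair `(z1,z2)` of complex numbers is `(n1,n2)`-independent if, for all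
`a1, b1 ∈ 𝒩₁ = {n1-1-2r : 0 ≤ r ≤ n1-1}` and `a2, b2 ∈ 𝒩₂ = {n2-1-2r : 0 ≤ r ≤ n2-1}`,
`(a1-b1)z1 + (a2-b2)z2 = 0` implies `a1 = b1` and `a2 = b2`. -/
def IndepPair (n1 n2 : ℕ) (z1 z2 : ℂ) : Prop :=
  ∀ a1 b1 a2 b2 : ℤ,
    (∃ r : ℕ, r < n1 ∧ a1 = (n1 : ℤ) - 1 - 2 * r) →
    (∃ r : ℕ, r < n1 ∧ b1 = (n1 : ℤ) - 1 - 2 * r) →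
    (∃ r : ℕ, r < n2 ∧ a2 = (n2 : ℤ) - 1 - 2 * r) →
    (∃ r : ℕ, r < n2 ∧ b2 = (n2 : ℤ) - 1 - 2 * r) →
    ((a1 - b1 : ℤ) : ℂ) * z1 + ((a2 - b2 : ℤ) : ℂ) * z2 = 0 →
    a1 = b1 ∧ a2 = b2

/-- `K(n1,n2,x,y)` as a matrix indexed by `Fin (n1·n2)`, placing the pair `(u,v)` at the
0-based position `u·n2 + v`. -/
def kac2Fin (n1 n2 : ℕ) (x y : ℝ) : Matrix (Fin (n1 * n2)) (Fin (n1 * n2)) ℝ :=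
  Matrix.reindex finProdFinEquiv finProdFinEquiv (kac2M ℝ n1 n2 x y)

/-- The matrix `Q(n1,n2,τ1,τ2) = [[K, I],[0, K]]` (blocks of order `n1·n2`),
where `K = K(n1,n2,τ1,τ2)`, indexed by `Fin (2·n1·n2)`. -/
def Qmat (n1 n2 : ℕ) (τ1 τ2 : ℝ) :
    Matrix (Fin (2 * (n1 * n2))) (Fin (2 * (n1 * n2))) ℝ :=
  Matrix.reindex (finSumFinEquiv.trans (finCongr (two_mul (n1 * n2)).symm))
    (finSumFinEquiv.trans (finCongr (two_mul (n1 * n2)).symm))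
    (Matrix.fromBlocks (kac2Fin n1 n2 τ1 τ2) 1 0 (kac2Fin n1 n2 τ1 τ2))

/-- The first standard basis row vector `e1 = (1,0,…,0)` of `ℝ^n`. -/
def e1v (n : ℕ) : Fin n → ℝ := fun i => if (i : ℕ) = 0 then 1 else 0

/-- The `(2n1n2-1) × (2n1n2)` matrix `M̄(n1,n2,τ1,τ2)` whose `i`-th row (1-based) is
the row vector `e1·Q^{i+1}`. -/
def Mbar (n1 n2 : ℕ) (τ1 τ2 : ℝ) :
    Matrix (Fin (2 * (n1 * n2) - 1)) (Fin (2 * (n1 * n2))) ℝ :=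
  Matrix.of fun i j =>
    Matrix.vecMul (e1v (2 * (n1 * n2))) (Qmat n1 n2 τ1 τ2 ^ ((i : ℕ) + 2)) j

/-- The square matrix `M(n1,n2,τ1,τ2)` of order `2n1n2-1` obtained from `M̄` by deleting
its first column. -/
def Mmat (n1 n2 : ℕ) (τ1 τ2 : ℝ) :
    Matrix (Fin (2 * (n1 * n2) - 1)) (Fin (2 * (n1 * n2) - 1)) ℝ :=
  Matrix.of fun i j =>
    Mbar n1 n2 τ1 τ2 i ⟨(j : ℕ) + 1, by have := j.isLt; omega⟩

section Helpers
open Polynomial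

lemma aux_deriv_pow (a : ℕ) (z : ℂ) :
    (1 + C z * X) * derivative ((1 + C z * X) ^ a : ℂ[X]) = C ((a : ℂ) * z) * (1 + C z * X) ^ a := by
  cases a with
  | zero => simp
  | succ k =>
    rw [derivative_pow]
    simp only [Nat.add_sub_cancel, derivative_add, derivative_one, derivative_mul, derivative_C,
      derivative_X, C_mul, zero_mul, mul_one, zero_add]
    ring

/-- eigenpolynomial -/
def kacPoly (n r : ℕ) (z : ℂ) : ℂ[X] := (1 + C z * X) ^ (n - 1 - r) * (1 + C (-z) * X) ^ r

lemma kacPoly_ode (n r : ℕ) (hr : r < n) (z : ℂ) :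
    derivative (kacPoly n r z) * (1 - C (z ^ 2) * X ^ 2) + C (((n : ℂ) - 1) * z ^ 2) * X * kacPoly n r z
      = C (((n : ℂ) - 1 - 2 * r) * z) * kacPoly n r z := by
  obtain ⟨a, rfl⟩ : ∃ a, n = a + r + 1 := ⟨n - 1 - r, by omega⟩
  have e : a + r + 1 - 1 - r = a := by omega
  unfold kacPoly
  rw [e, derivative_mul]
  have h1 := aux_deriv_pow a z
  have h2 := aux_deriv_pow r (-z)
  push_cast
  have h3 : (C (2 : ℂ) : ℂ[X]) = 2 := rfl
  simp only [C_mul, C_neg, C_sub, C_add, C_pow, C_1, h3] at *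
  linear_combination (1 + -C z * X) * (1 + -C z * X) ^ r * h1 + (1 + C z * X) * (1 + C z * X) ^ a * h2

lemma kacPoly_coeff_zero (n r : ℕ) (z : ℂ) : (kacPoly n r z).coeff 0 = 1 := by
  simp [kacPoly, coeff_zero_eq_eval_zero]

lemma kacPoly_natDegree (n r : ℕ) (hr : r < n) (z : ℂ) : (kacPoly n r z).natDegree ≤ n - 1 := by
  have h : ∀ w : ℂ, (1 + C w * X : ℂ[X]).natDegree ≤ 1 := by
    intro w; compute_degree
  unfold kacPoly
  refine natDegree_mul_le.trans ?_
  have h1 := natDegree_pow_le_of_le (n - 1 - r) (h z)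
  have h2 := natDegree_pow_le_of_le r (h (-z))
  omega

lemma kac_eig (n r : ℕ) (hr : r < n) (z : ℂ) :
    kacM ℂ n (z ^ 2) *ᵥ (fun i : Fin n => (kacPoly n r z).coeff i)
      = (((n : ℂ) - 1 - 2 * r) * z) • (fun i : Fin n => (kacPoly n r z).coeff i) := by
  have ode := kacPoly_ode n r hr z
  have hd := kacPoly_natDegree n r hr z
  set f := kacPoly n r z
  ext i
  have hi := congrArg (fun p => coeff p (i : ℕ)) ode
  have hn : f.coeff n = 0 := coeff_eq_zero_of_natDegree_lt (by omega)
  simp only [mulVec, dotProduct, kacM, Matrix.of_apply, Pi.smul_apply, smul_eq_mul]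
  have hs := Finset.sum_range (n := n) (fun j : ℕ =>
    (if (i : ℕ) = j + 1 then ((n - 1 - j : ℕ) : ℂ) * z ^ 2
    else if j = (i : ℕ) + 1 then (((i : ℕ) + 1 : ℕ) : ℂ) else 0) * f.coeff j)
  rw [← hs]
  have hsplit : ∀ j, (if (i : ℕ) = j + 1 then ((n - 1 - j : ℕ) : ℂ) * z ^ 2
    else if j = (i : ℕ) + 1 then (((i : ℕ) + 1 : ℕ) : ℂ) else 0) * f.coeff j
    = (if (i : ℕ) = j + 1 then ((n - 1 - j : ℕ) : ℂ) * z ^ 2 * f.coeff j else 0)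
      + (if j = (i : ℕ) + 1 then (((i : ℕ) + 1 : ℕ) : ℂ) * f.coeff j else 0) := by
    intro j
    split_ifs with ha hb
    · omega
    · simp
    · simp
    · simp
  simp only [hsplit, Finset.sum_add_distrib, Finset.sum_ite_eq', Finset.mem_range]
  have hB : (if (i : ℕ) + 1 < n then (((i : ℕ) + 1 : ℕ) : ℂ) * f.coeff ((i : ℕ) + 1) else 0)
      = (((i : ℕ) + 1 : ℕ) : ℂ) * f.coeff ((i : ℕ) + 1) := by
    split_ifs with h
    · rfl
    · have : (i : ℕ) + 1 = n := by have := i.isLt; omega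
      rw [this, hn, mul_zero]
  rw [hB]
  have hilt := i.isLt
  simp only [mul_sub, mul_one, coeff_add, coeff_sub, mul_assoc, coeff_C_mul, coeff_derivative] at hi
  rcases hk : (i : ℕ) with _ | k
  · rw [hk] at hi
    have e0 : (derivative f * (C (z ^ 2) * X ^ 2)).coeff 0 = 0 := by simp [mul_coeff_zero]
    rw [e0] at hi
    simp at hi ⊢
    linear_combination hi
  · rw [hk] at hi hilt
    have e1 : ∀ j, (k + 1 = j + 1) ↔ (j = k) := by intro j; omega
    simp only [e1, Finset.sum_ite_eq', Finset.mem_range]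
    rw [if_pos (by omega), Nat.sub_sub, Nat.cast_sub (by omega)]
    have e2 : (derivative f * (C (z ^ 2) * X ^ 2)).coeff (k + 1) = z ^ 2 * (k * f.coeff k) := by
      rw [show derivative f * (C (z ^ 2) * X ^ 2) = C (z ^ 2) * (derivative f * X * X) by ring,
        coeff_C_mul, coeff_mul_X]
      cases k with
      | zero => simp [mul_coeff_zero]
      | succ m => rw [coeff_mul_X, coeff_derivative]; push_cast; ring
    rw [e2, coeff_X_mul] at hi
    push_cast at hi ⊢
    linear_combination hi

lemma kac2_apply (R : Type*) [CommRing R] (n1 n2 : ℕ) (x y : R) (p q : Fin n1 × Fin n2) :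
    kac2M R n1 n2 x y p q = (if p.2 = q.2 then kacM R n1 x p.1 q.1 else 0)
      + (if p.1 = q.1 then kacM R n2 y p.2 q.2 else 0) := by
  simp only [kac2M, kacM, Matrix.of_apply]
  by_cases h : p.1 = q.1
  · simp [h]
  · simp only [h, if_false, add_zero]
    split_ifs <;> rfl

lemma kac2_eig (n1 n2 : ℕ) (x y a b : ℂ) (v : Fin n1 → ℂ) (w : Fin n2 → ℂ)
    (hv : kacM ℂ n1 x *ᵥ v = a • v) (hw : kacM ℂ n2 y *ᵥ w = b • w) :
    kac2M ℂ n1 n2 x y *ᵥ (fun p => v p.1 * w p.2) = (a + b) • (fun p => v p.1 * w p.2) := by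
  ext p
  have h1 := congrFun hv p.1
  have h2 := congrFun hw p.2
  simp only [mulVec, dotProduct, Pi.smul_apply, smul_eq_mul] at h1 h2 ⊢
  simp only [kac2_apply, add_mul, Finset.sum_add_distrib, ite_mul, zero_mul]
  rw [Fintype.sum_prod_type, Fintype.sum_prod_type_right]
  simp only [Finset.sum_ite_eq, Finset.mem_univ, if_true]
  rw [← mul_assoc, ← h1, mul_left_comm, ← h2, Finset.sum_mul, Finset.mul_sum]
  congr 1
  · exact Finset.sum_congr rfl fun _ _ => by ring
  · exact Finset.sum_congr rfl fun _ _ => by ring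

end Helpers
section Helpers2
open Polynomial

variable {ι : Type*} [Fintype ι] [DecidableEq ι]

lemma blk_U (K : Matrix ι ι ℂ) (v : ι → ℂ) (l : ℂ) (hv : K *ᵥ v = l • v) (p : ℂ[X]) :
    (aeval (fromBlocks K 1 0 K) p) *ᵥ (Sum.elim v 0) = p.eval l • Sum.elim v 0 := by
  have hB : (fromBlocks K 1 0 K) *ᵥ (Sum.elim v 0) = l • Sum.elim v 0 := by
    rw [fromBlocks_mulVec]
    ext (i | i) <;> simp [hv]
  induction p using Polynomial.induction_on' with
  | add p q hp hq => rw [map_add, add_mulVec, hp, hq, eval_add, add_smul]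
  | monomial n a =>
    rw [aeval_monomial, eval_monomial, Algebra.algebraMap_eq_smul_one, smul_mul_assoc, one_mul,
      smul_mulVec, mul_smul]
    congr 1
    induction n with
    | zero => simp
    | succ n ih => rw [pow_succ, ← mulVec_mulVec, hB, mulVec_smul, ih, smul_smul, pow_succ, mul_comm]

lemma blk_W (K : Matrix ι ι ℂ) (v : ι → ℂ) (l : ℂ) (hv : K *ᵥ v = l • v) (p : ℂ[X]) :
    (aeval (fromBlocks K 1 0 K) p) *ᵥ (Sum.elim (0 : ι → ℂ) v)
      = p.eval l • Sum.elim (0 : ι → ℂ) v + p.derivative.eval l • Sum.elim v 0 := by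
  have hB : (fromBlocks K 1 0 K) *ᵥ (Sum.elim (0 : ι → ℂ) v) = l • Sum.elim (0 : ι → ℂ) v + Sum.elim v 0 := by
    rw [fromBlocks_mulVec]
    ext (i | i) <;> simp [hv]
  induction p using Polynomial.induction_on' with
  | add p q hp hq =>
    rw [map_add, add_mulVec, hp, hq, derivative_add, eval_add, eval_add, add_smul, add_smul]; abel
  | monomial n a =>
    rw [aeval_monomial, derivative_monomial, eval_monomial, eval_monomial,
      Algebra.algebraMap_eq_smul_one, smul_mul_assoc, one_mul,
      smul_mulVec, mul_smul, mul_assoc, mul_smul, ← smul_add]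
    congr 1
    induction n with
    | zero => simp
    | succ n ih =>
      have hU := blk_U K v l hv (X ^ n)
      simp only [map_pow, aeval_X, eval_pow, eval_X] at hU
      rw [pow_succ, ← mulVec_mulVec, hB, mulVec_add, mulVec_smul, ih, hU]
      cases n with
      | zero => ext (i | i) <;> simp
      | succ m =>
        ext (i | i) <;> simp <;> ring

lemma eig_zero (K : Matrix ι ι ℂ) (V : ι → ι → ℂ) (lam : ι → ℂ) (hinj : Function.Injective lam)
    (hV : ∀ μ, K *ᵥ V μ = lam μ • V μ) (hne : ∀ μ, V μ ≠ 0) (a : ι → ℂ)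
    (ha : ∀ μ, a ⬝ᵥ V μ = 0) : a = 0 := by
  have hli : LinearIndependent ℂ V := by
    refine Module.End.eigenvectors_linearIndependent' (Matrix.toLin' K) lam hinj V ?_
    intro μ
    refine ⟨?_, hne μ⟩
    rw [Module.End.mem_eigenspace_iff, Matrix.toLin'_apply, hV]
  have hu : IsUnit (Matrix.of V) := by
    rw [← Matrix.linearIndependent_rows_iff_isUnit]
    exact hli
  have h0 : (Matrix.of V) *ᵥ a = 0 := by
    ext μ
    simp only [mulVec, Pi.zero_apply]
    rw [dotProduct_comm]; exact ha μ
  have := Matrix.mulVec_injective_of_isUnit hu (a₁ := a) (a₂ := 0) (by simpa using h0)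
  exact this

lemma row_dot (A : Matrix (ι ⊕ ι) (ι ⊕ ι) ℂ) (i : ι ⊕ ι) (u : ι ⊕ ι → ℂ) :
    A i ⬝ᵥ u = (A *ᵥ u) i := rfl

lemma row_iff (K : Matrix ι ι ℂ) (V : ι → ι → ℂ) (lam : ι → ℂ) (hinj : Function.Injective lam)
    (hV : ∀ μ, K *ᵥ V μ = lam μ • V μ) (o : ι) (ho : ∀ μ, V μ o = 1) (p : ℂ[X]) :
    (∀ j, j ≠ Sum.inl o → (aeval (fromBlocks K 1 0 K) p) (Sum.inl o) j = 0) ↔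
      ∃ κ, ∀ μ, p.eval (lam μ) = κ ∧ p.derivative.eval (lam μ) = 0 := by
  set A := aeval (fromBlocks K 1 0 K) p with hA
  have hU : ∀ μ, A (Sum.inl o) ⬝ᵥ (Sum.elim (V μ) 0) = p.eval (lam μ) := by
    intro μ
    rw [row_dot, hA, blk_U K (V μ) (lam μ) (hV μ) p]; simp [ho]
  have hW : ∀ μ, A (Sum.inl o) ⬝ᵥ (Sum.elim (0 : ι → ℂ) (V μ)) = p.derivative.eval (lam μ) := by
    intro μ
    rw [row_dot, hA, blk_W K (V μ) (lam μ) (hV μ) p]; simp [ho]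
  constructor
  · intro h
    refine ⟨A (Sum.inl o) (Sum.inl o), fun μ => ⟨?_, ?_⟩⟩
    · rw [← hU, dotProduct, Finset.sum_eq_single (Sum.inl o)]
      · simp [ho]
      · intro b _ hb; rw [h b hb, zero_mul]
      · simp
    · rw [← hW, dotProduct, Finset.sum_eq_single (Sum.inl o)]
      · simp
      · intro b _ hb; rw [h b hb, zero_mul]
      · simp
  · rintro ⟨κ, h⟩
    have hne : ∀ μ, V μ ≠ 0 := fun μ h0 => by have := ho μ; rw [h0] at this; simp at this
    have ha := eig_zero K V lam hinj hV hne
      (fun i => A (Sum.inl o) (Sum.inl i) - if i = o then κ else 0) (by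
        intro μ
        have := hU μ
        rw [(h μ).1] at this
        simp only [dotProduct, Fintype.sum_sum_type, Sum.elim_inl, Sum.elim_inr, Pi.zero_apply,
          mul_zero, Finset.sum_const_zero, add_zero] at this
        simp only [dotProduct, sub_mul, Finset.sum_sub_distrib, this, ite_mul, zero_mul,
          Finset.sum_ite_eq', Finset.mem_univ, if_true, ho]
        ring)
    have hb := eig_zero K V lam hinj hV hne
      (fun i => A (Sum.inl o) (Sum.inr i)) (by
        intro μ
        have := hW μ
        rw [(h μ).2] at this
        simpa only [dotProduct, Fintype.sum_sum_type, Sum.elim_inl, Sum.elim_inr, Pi.zero_apply,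
          mul_zero, Finset.sum_const_zero, zero_add] using this)
    rintro (j | j) hj
    · have := congrFun ha j
      have hj' : j ≠ o := fun h => hj (by rw [h])
      simpa [hj'] using this
    · exact congrFun hb j

/-- polynomial with low degree and constant double values is constant -/
lemma poly_const (lam : ι → ℂ) (hinj : Function.Injective lam) (p : ℂ[X]) (κ : ℂ)
    (hdeg : p.degree < (2 * Fintype.card ι : ℕ)) (hpos : 0 < Fintype.card ι)
    (h : ∀ μ, p.eval (lam μ) = κ ∧ p.derivative.eval (lam μ) = 0) : p = C κ := by
  rw [← sub_eq_zero]
  have hd : ∏ μ, (X - C (lam μ)) ^ 2 ∣ p - C κ := by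
    refine Fintype.prod_dvd_of_coprime ?_ ?_
    · intro a b hab
      exact (isCoprime_X_sub_C_of_isUnit_sub
        (sub_ne_zero.mpr (fun e => hab (hinj e))).isUnit).pow
    · intro μ
      by_cases h0 : p - C κ = 0
      · rw [h0]; exact dvd_zero _
      · rw [← le_rootMultiplicity_iff h0]
        have := (one_lt_rootMultiplicity_iff_isRoot (t := lam μ) h0).mpr
          ⟨by simp [(h μ).1], by simp [(h μ).2]⟩
        omega
  refine eq_zero_of_dvd_of_degree_lt hd ?_
  have : (∏ μ, (X - C (lam μ)) ^ 2 : ℂ[X]).degree = (2 * Fintype.card ι : ℕ) := by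
    rw [degree_prod]
    simp [degree_pow, mul_comm]
  rw [this]
  refine (degree_sub_le _ _).trans_lt (max_lt hdeg (degree_C_le.trans_lt ?_))
  exact_mod_cast (by omega : 0 < 2 * Fintype.card ι)

/-- the polynomial witnessing the kernel -/
lemma poly_exists (lam : ι → ℂ) (σ : ι ≃ ι) (hσ : ∀ μ, lam (σ μ) = - lam μ)
    (hev : Even (Fintype.card ι)) (hpos : 0 < Fintype.card ι) :
    ∃ p : ℂ[X], p.natDegree = 2 * Fintype.card ι ∧ p.coeff 0 = 0 ∧ p.coeff 1 = 0 ∧ p.Monic ∧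
      ∃ κ, ∀ μ, p.eval (lam μ) = κ ∧ p.derivative.eval (lam μ) = 0 := by
  set χ : ℂ[X] := ∏ μ, (X - C (lam μ)) with hχ
  have hm : χ.Monic := monic_prod_of_monic _ _ fun μ _ => monic_X_sub_C _
  have hdχ : χ.natDegree = Fintype.card ι := by
    rw [hχ, natDegree_prod_of_monic _ _ fun μ _ => monic_X_sub_C _]; simp
  have hroot : ∀ μ, χ.eval (lam μ) = 0 := by
    intro μ
    rw [hχ, eval_prod]
    exact Finset.prod_eq_zero (Finset.mem_univ μ) (by simp)
  have hcomp : χ.comp (-X) = χ := by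
    rw [hχ, prod_comp]
    have e1 : ∀ μ, (X - C (lam μ)).comp (-X) = -(X - C (lam (σ μ))) := by
      intro μ; rw [hσ]; simp; ring
    simp only [e1]
    rw [Finset.prod_neg, Finset.card_univ, hev.neg_one_pow, one_mul]
    exact Equiv.prod_comp σ (fun μ => (X - C (lam μ) : ℂ[X]))
  have hder : χ.derivative.eval 0 = 0 := by
    have := congrArg (fun q => (derivative q).eval 0) hcomp
    simp only [derivative_comp, eval_mul, eval_comp] at this
    simp at this
    linear_combination (-1 / 2 : ℂ) * this
  have hdq : (χ ^ 2).natDegree = 2 * Fintype.card ι := by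
    rw [hm.natDegree_pow, hdχ]
  refine ⟨χ ^ 2 - C ((χ.eval 0) ^ 2), ?_, ?_, ?_, ?_, -(χ.eval 0) ^ 2, fun μ => ⟨?_, ?_⟩⟩
  · rw [natDegree_sub_C, hdq]
  · simp [coeff_zero_eq_eval_zero]
  · have h1 : (χ ^ 2 - C ((χ.eval 0) ^ 2)).derivative.coeff 0 = 0 := by
      rw [coeff_zero_eq_eval_zero, derivative_sub, derivative_C, derivative_pow]
      simp [hder]
    rw [coeff_derivative] at h1
    simpa using h1
  · apply (hm.pow 2).sub_of_left
    refine degree_C_le.trans_lt ?_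
    rw [degree_eq_natDegree (hm.pow 2).ne_zero, hdq]
    exact_mod_cast (by omega : 0 < 2 * Fintype.card ι)
  · simp [hroot]
  · simp [derivative_pow, hroot]

end Helpers2
section Helpers3
open Polynomial

/-- the eigenvalues -/
def kacLam (n1 n2 : ℕ) (z1 z2 : ℂ) (μ : Fin n1 × Fin n2) : ℂ :=
  ((n1 : ℂ) - 1 - 2 * (μ.1 : ℕ)) * z1 + ((n2 : ℂ) - 1 - 2 * (μ.2 : ℕ)) * z2

/-- the eigenvectors -/
def kacVec (n1 n2 : ℕ) (z1 z2 : ℂ) (μ : Fin n1 × Fin n2) (p : Fin n1 × Fin n2) : ℂ :=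
  (kacPoly n1 μ.1 z1).coeff p.1 * (kacPoly n2 μ.2 z2).coeff p.2

lemma kacLam_inj (n1 n2 : ℕ) (z1 z2 : ℂ) (hind : IndepPair n1 n2 z1 z2) :
    Function.Injective (kacLam n1 n2 z1 z2) := by
  rintro ⟨a, b⟩ ⟨c, d⟩ h
  have := hind _ _ _ _ ⟨a, a.isLt, rfl⟩ ⟨c, c.isLt, rfl⟩ ⟨b, b.isLt, rfl⟩ ⟨d, d.isLt, rfl⟩ (by
    simp only [kacLam] at h
    push_cast
    linear_combination h)
  ext
  · have := this.1; simp only; omega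
  · have := this.2; simp only; omega

lemma kacLam_rev (n1 n2 : ℕ) (z1 z2 : ℂ) (μ : Fin n1 × Fin n2) :
    kacLam n1 n2 z1 z2 ((Equiv.prodCongr Fin.revPerm Fin.revPerm) μ) = - kacLam n1 n2 z1 z2 μ := by
  obtain ⟨a, b⟩ := μ
  have ha := a.isLt
  have hb := b.isLt
  simp only [kacLam, Equiv.prodCongr_apply, Prod.map, Fin.revPerm_apply, Fin.val_rev]
  rw [Nat.cast_sub (by omega), Nat.cast_sub (by omega)]
  push_cast
  ring

/-- the total index equivalence -/
def bigE (n1 n2 : ℕ) : (Fin n1 × Fin n2) ⊕ (Fin n1 × Fin n2) ≃ Fin (2 * (n1 * n2)) :=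
  (Equiv.sumCongr finProdFinEquiv finProdFinEquiv).trans
    (finSumFinEquiv.trans (finCongr (two_mul (n1 * n2)).symm))

/-- complex block matrix -/
def bigB (n1 n2 : ℕ) (τ1 τ2 : ℝ) :
    Matrix ((Fin n1 × Fin n2) ⊕ (Fin n1 × Fin n2)) ((Fin n1 × Fin n2) ⊕ (Fin n1 × Fin n2)) ℂ :=
  fromBlocks (kac2M ℂ n1 n2 τ1 τ2) 1 0 (kac2M ℂ n1 n2 τ1 τ2)

lemma kac2_map (n1 n2 : ℕ) (τ1 τ2 : ℝ) (p q : Fin n1 × Fin n2) :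
    ((kac2M ℝ n1 n2 τ1 τ2 p q : ℝ) : ℂ) = kac2M ℂ n1 n2 τ1 τ2 p q := by
  simp only [kac2M, kacM, Matrix.of_apply]
  split_ifs <;> simp

lemma Qmat_map (n1 n2 : ℕ) (τ1 τ2 : ℝ) :
    (Complex.ofRealHom.mapMatrix (Qmat n1 n2 τ1 τ2))
      = Matrix.reindexAlgEquiv ℂ ℂ (bigE n1 n2) (bigB n1 n2 τ1 τ2) := by
  ext i j
  obtain ⟨i, rfl⟩ := (bigE n1 n2).surjective i
  obtain ⟨j, rfl⟩ := (bigE n1 n2).surjective j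
  rw [Matrix.reindexAlgEquiv_apply, Matrix.reindex_apply, Matrix.submatrix_apply,
    Equiv.symm_apply_apply, Equiv.symm_apply_apply]
  rw [RingHom.mapMatrix_apply, Matrix.map_apply]
  have hs : ∀ x, (finSumFinEquiv.trans (finCongr (two_mul (n1 * n2)).symm)).symm (bigE n1 n2 x)
      = Equiv.sumCongr finProdFinEquiv finProdFinEquiv x :=
    fun x => Equiv.symm_apply_apply _ _
  unfold Qmat bigB kac2Fin
  rw [Matrix.reindex_apply, Matrix.submatrix_apply, hs, hs]
  rcases i with i | i <;> rcases j with j | j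
  · simp [kac2_map]
  · simp [Matrix.one_apply]
  · simp
  · simp [kac2_map]

lemma bigE_zero (n1 n2 : ℕ) (h1 : 0 < n1) (h2 : 0 < n2) :
    ((bigE n1 n2 (Sum.inl (⟨0, h1⟩, ⟨0, h2⟩)) : Fin _) : ℕ) = 0 := by
  simp [bigE, finProdFinEquiv]

lemma Mmat_entry (n1 n2 : ℕ) (h1 : 0 < n1) (h2 : 0 < n2) (τ1 τ2 : ℝ)
    (i j : Fin (2 * (n1 * n2) - 1)) :
    ((Mmat n1 n2 τ1 τ2 i j : ℝ) : ℂ) = (bigB n1 n2 τ1 τ2 ^ ((i : ℕ) + 2))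
      (Sum.inl (⟨0, h1⟩, ⟨0, h2⟩)) ((bigE n1 n2).symm ⟨(j : ℕ) + 1, by have := j.isLt; omega⟩) := by
  set k := (i : ℕ) + 2 with hk
  have hQ : Complex.ofRealHom.mapMatrix (Qmat n1 n2 τ1 τ2 ^ k)
      = Matrix.reindexAlgEquiv ℂ ℂ (bigE n1 n2) (bigB n1 n2 τ1 τ2 ^ k) := by
    rw [map_pow, map_pow, Qmat_map]
  have hz := bigE_zero n1 n2 h1 h2
  set o := bigE n1 n2 (Sum.inl (⟨0, h1⟩, ⟨0, h2⟩)) with ho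
  have hM : Mmat n1 n2 τ1 τ2 i j
      = (Qmat n1 n2 τ1 τ2 ^ k) o ⟨(j : ℕ) + 1, by have := j.isLt; omega⟩ := by
    simp only [Mmat, Mbar, Matrix.of_apply, Matrix.vecMul, dotProduct, e1v]
    rw [Finset.sum_eq_single o]
    · simp [hz, hk]
    · intro b _ hb
      rw [if_neg, zero_mul]
      intro h; apply hb; ext; rw [hz, h]
    · simp
  rw [hM]
  have := congrFun (congrFun hQ o) ⟨(j : ℕ) + 1, by have := j.isLt; omega⟩
  rw [Matrix.reindexAlgEquiv_apply, Matrix.reindex_apply, Matrix.submatrix_apply, ho,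
    Equiv.symm_apply_apply] at this
  exact this

/-- polynomial of a coefficient vector -/
def vecPoly (m : ℕ) (c : Fin m → ℂ) : ℂ[X] := ∑ i : Fin m, C (c i) * X ^ ((i : ℕ) + 2)

lemma vecPoly_coeff (m : ℕ) (c : Fin m → ℂ) (i : Fin m) :
    (vecPoly m c).coeff ((i : ℕ) + 2) = c i := by
  simp only [vecPoly, finsetSum_coeff, coeff_C_mul, coeff_X_pow]
  rw [Finset.sum_eq_single i]
  · simp
  · intro b _ hb
    rw [if_neg, mul_zero]
    intro h; apply hb; ext; omega
  · simp

lemma vecPoly_coeff_zero (m : ℕ) (c : Fin m → ℂ) : (vecPoly m c).coeff 0 = 0 := by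
  simp only [vecPoly, finsetSum_coeff, coeff_C_mul, coeff_X_pow]
  refine Finset.sum_eq_zero fun i _ => ?_
  rw [if_neg (by omega), mul_zero]

lemma vecPoly_coeff_one (m : ℕ) (c : Fin m → ℂ) : (vecPoly m c).coeff 1 = 0 := by
  simp only [vecPoly, finsetSum_coeff, coeff_C_mul, coeff_X_pow]
  refine Finset.sum_eq_zero fun i _ => ?_
  rw [if_neg (by omega), mul_zero]

lemma vecPoly_coeff_big (m : ℕ) (c : Fin m → ℂ) (k : ℕ) (hk : m + 2 ≤ k) :
    (vecPoly m c).coeff k = 0 := by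
  simp only [vecPoly, finsetSum_coeff, coeff_C_mul, coeff_X_pow]
  refine Finset.sum_eq_zero fun i _ => ?_
  have := i.isLt
  rw [if_neg (by omega), mul_zero]

lemma ker_iff (n1 n2 : ℕ) (h1 : 0 < n1) (h2 : 0 < n2) (τ1 τ2 : ℝ) (z1 z2 : ℂ)
    (hz1 : z1 ^ 2 = (τ1 : ℂ)) (hz2 : z2 ^ 2 = (τ2 : ℂ))
    (hind : IndepPair n1 n2 z1 z2) (c : Fin (2 * (n1 * n2) - 1) → ℂ) :
    c ᵥ* (Complex.ofRealHom.mapMatrix (Mmat n1 n2 τ1 τ2)) = 0 ↔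
      ∃ κ, ∀ μ, (vecPoly _ c).eval (kacLam n1 n2 z1 z2 μ) = κ ∧
        (vecPoly _ c).derivative.eval (kacLam n1 n2 z1 z2 μ) = 0 := by
  have hV : ∀ μ, kac2M ℂ n1 n2 τ1 τ2 *ᵥ kacVec n1 n2 z1 z2 μ
      = kacLam n1 n2 z1 z2 μ • kacVec n1 n2 z1 z2 μ := by
    intro μ
    rw [← hz1, ← hz2]
    have h := kac2_eig n1 n2 (z1 ^ 2) (z2 ^ 2) _ _ _ _ (kac_eig n1 μ.1 μ.1.isLt z1)
      (kac_eig n2 μ.2 μ.2.isLt z2)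
    exact h
  rw [← row_iff (kac2M ℂ n1 n2 τ1 τ2) (kacVec n1 n2 z1 z2) (kacLam n1 n2 z1 z2)
    (kacLam_inj n1 n2 z1 z2 hind) hV (⟨0, h1⟩, ⟨0, h2⟩)
    (fun μ => by simp [kacVec, kacPoly_coeff_zero])]
  have key : ∀ j : Fin (2 * (n1 * n2) - 1),
      (c ᵥ* (Complex.ofRealHom.mapMatrix (Mmat n1 n2 τ1 τ2))) j
      = (aeval (bigB n1 n2 τ1 τ2) (vecPoly _ c)) (Sum.inl (⟨0, h1⟩, ⟨0, h2⟩))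
        ((bigE n1 n2).symm ⟨(j : ℕ) + 1, by have := j.isLt; omega⟩) := by
    intro j
    simp only [vecPoly, map_sum, map_mul, aeval_C, map_pow, aeval_X, Matrix.sum_apply,
      Algebra.algebraMap_eq_smul_one, smul_mul_assoc, one_mul, Matrix.smul_apply, smul_eq_mul,
      Matrix.vecMul, dotProduct]
    refine Finset.sum_congr rfl fun i _ => ?_
    rw [← Mmat_entry n1 n2 h1 h2 τ1 τ2 i j]
    rfl
  have hz := bigE_zero n1 n2 h1 h2
  constructor
  · intro h j hj
    obtain ⟨j, rfl⟩ := (bigE n1 n2).symm.surjective j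
    have hj0 : (j : ℕ) ≠ 0 := by
      intro h0
      apply hj
      rw [Equiv.symm_apply_eq]
      ext; rw [hz, h0]
    have := key ⟨(j : ℕ) - 1, by have := j.isLt; omega⟩
    rw [h] at this
    have e : (⟨((j : ℕ) - 1) + 1, by have := j.isLt; omega⟩ : Fin (2 * (n1 * n2))) = j := by
      ext; simp only; omega
    simp only [e] at this
    exact this.symm
  · intro h
    ext j
    rw [key]
    apply h
    intro h0
    rw [Equiv.symm_apply_eq] at h0
    have := congrArg Fin.val h0
    rw [hz] at this
    simp at this

end Helpers3

/-- If `n1·n2` is even and `τ1 = z1²`, `τ2 = z2²` with `(z1,z2)`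
`(n1,n2)`-independent, then the square matrix `M(n1,n2,τ1,τ2)` of order `2n1n2-1` has
rank exactly `2n1n2-2`. -/
theorem Mmat_rank (n1 n2 : ℕ) (h1 : 2 ≤ n1) (h2 : 2 ≤ n2)
    (heven : Even (n1 * n2)) (τ1 τ2 : ℝ) (z1 z2 : ℂ)
    (hz1 : z1 ^ 2 = (τ1 : ℂ)) (hz2 : z2 ^ 2 = (τ2 : ℂ))
    (hind : IndepPair n1 n2 z1 z2) :
    (Mmat n1 n2 τ1 τ2).rank = 2 * (n1 * n2) - 2 := by
  classical
  have h1' : 0 < n1 := by omega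
  have h2' : 0 < n2 := by omega
  have hN : 0 < n1 * n2 := Nat.mul_pos h1' h2'
  have hcard : Fintype.card (Fin n1 × Fin n2) = n1 * n2 := by simp
  set m := 2 * (n1 * n2) - 1 with hm
  have hk := ker_iff n1 n2 h1' h2' τ1 τ2 z1 z2 hz1 hz2 hind
  set A := Mmat n1 n2 τ1 τ2 with hA
  -- a nonzero kernel vector
  have hdet : A.det = 0 := by
    have hC : (Complex.ofRealHom.mapMatrix A).det = 0 := by
      rw [← Matrix.exists_vecMul_eq_zero_iff]
      obtain ⟨p, hd, hc0, hc1, hmon, hp⟩ := poly_exists (kacLam n1 n2 z1 z2)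
        (Equiv.prodCongr Fin.revPerm Fin.revPerm) (kacLam_rev n1 n2 z1 z2)
        (by rw [hcard]; exact heven) (by rw [hcard]; exact hN)
      rw [hcard] at hd
      have hpe : vecPoly m (fun i => p.coeff ((i : ℕ) + 2)) = p := by
        ext k
        rcases k with _ | _ | k
        · rw [vecPoly_coeff_zero, hc0]
        · rw [vecPoly_coeff_one, hc1]
        · by_cases hkm : k < m
          · exact vecPoly_coeff m _ ⟨k, hkm⟩
          · rw [vecPoly_coeff_big _ _ _ (by omega),
              Polynomial.coeff_eq_zero_of_natDegree_lt (by omega)]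
      refine ⟨fun i => p.coeff ((i : ℕ) + 2), ?_, ?_⟩
      · intro h
        have h3 := congrFun h ⟨m - 1, by omega⟩
        have h4 := hmon.coeff_natDegree
        rw [hd, show 2 * (n1 * n2) = m - 1 + 2 by omega] at h4
        simp only [h4] at h3
        exact one_ne_zero h3
      · rw [hk, hpe]; exact hp
    rw [← RingHom.map_det] at hC
    exact (map_eq_zero Complex.ofRealHom).mp hC
  have hub : 0 < Module.finrank ℝ (LinearMap.ker (Aᵀ).mulVecLin) := by
    obtain ⟨v, hv, hv0⟩ := Matrix.exists_vecMul_eq_zero_iff.mpr hdet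
    rw [Module.finrank_pos_iff_exists_ne_zero]
    refine ⟨⟨v, ?_⟩, ?_⟩
    · rw [LinearMap.mem_ker, Matrix.mulVecLin_apply, Matrix.mulVec_transpose, hv0]
    · intro h; exact hv (congrArg Subtype.val h)
  have hlb : Module.finrank ℝ (LinearMap.ker (Aᵀ).mulVecLin) ≤ 1 := by
    have hinj : Function.Injective ((LinearMap.proj (⟨m - 1, by omega⟩ : Fin m) :
        (Fin m → ℝ) →ₗ[ℝ] ℝ).comp (LinearMap.ker (Aᵀ).mulVecLin).subtype) := by
      rw [← LinearMap.ker_eq_bot, LinearMap.ker_eq_bot']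
      rintro ⟨c, hc⟩ hc0
      rw [LinearMap.mem_ker, Matrix.mulVecLin_apply, Matrix.mulVec_transpose] at hc
      have hl : c ⟨m - 1, by omega⟩ = 0 := hc0
      have hcC : (fun i => (c i : ℂ)) ᵥ* (Complex.ofRealHom.mapMatrix A) = 0 := by
        ext j
        have := congrArg (fun x : ℝ => (x : ℂ)) (congrFun hc j)
        simpa [Matrix.vecMul, dotProduct] using this
      obtain ⟨κ, hκ⟩ := (hk _).mp hcC
      have hp := poly_const (kacLam n1 n2 z1 z2) (kacLam_inj n1 n2 z1 z2 hind) _ κ (by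
        rw [hcard, Polynomial.degree_lt_iff_coeff_zero]
        intro k hkk
        rcases hkk.eq_or_lt with h | h
        · have := vecPoly_coeff m (fun i => (c i : ℂ)) ⟨m - 1, by omega⟩
          rw [hl] at this
          rw [← h]
          convert this using 2
          · simp only; omega
          · simp
        · exact vecPoly_coeff_big _ _ _ (by omega)) (by rw [hcard]; exact hN) hκ
      apply Subtype.ext
      ext i
      have := vecPoly_coeff m (fun i => (c i : ℂ)) i
      rw [hp, Polynomial.coeff_C_of_ne_zero (by omega)] at this
      exact_mod_cast this.symm
    simpa using LinearMap.finrank_le_finrank_of_injective hinj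
  have hrn := LinearMap.finrank_range_add_finrank_ker (Aᵀ).mulVecLin
  have hrk : Module.finrank ℝ (LinearMap.range (Aᵀ).mulVecLin) = A.rank := by
    rw [← Matrix.rank_transpose A]; rfl
  rw [hrk, Module.finrank_fin_fun] at hrn
  omega
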